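/- Let R be a commutative local ring with maximal ideal m and residue field k = R/m, let M be an R-module equipped with a symmetric bilinear form B : M × M → R, and let N ⊆ M be a finite free R-submodule such that the bilinear form induced by the restriction B|_{N×N} on N ⊗_R k is nondegenerate. Then M decomposes as an internal direct sum M = N ⊕ N^⊥, where N^⊥ = { x ∈ M : B(n, x) = 0 for all n ∈ N }. -/

import Mathlib

open Module in
/-- A bilinear form on a finite free module whose Gram determinant is a unit is perfect. -/
theorem LinearMap.BilinForm.bijective_of_isUnit_det_toMatrix {R N ι : Type*} [CommRing R]
    [AddCommGroup N] [Module R N] [Fintype ι] [DecidableEq ι] (b : Basis ι R N)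
    (B : LinearMap.BilinForm R N) (h : IsUnit (BilinForm.toMatrix b B).det) :
    Function.Bijective B := by
  have key : LinearMap.toMatrix b b.dualBasis B = (BilinForm.toMatrix b B).transpose := by
    ext i j
    simp [LinearMap.toMatrix_apply, BilinForm.toMatrix_apply]
  rw [← Matrix.det_transpose, ← key] at h
  exact (LinearEquiv.ofIsUnitDet h).bijective

open Module in
/-- The Gram matrix of a base change is the image of the Gram matrix. -/
theorem LinearMap.BilinForm.toMatrix_baseChange {R N ι : Type*} (A : Type*) [CommRing R]
    [CommRing A] [Algebra R A] [AddCommGroup N] [Module R N] [Fintype ι] [DecidableEq ι]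
    (b : Basis ι R N) (B : LinearMap.BilinForm R N) :
    BilinForm.toMatrix (b.baseChange A) (B.baseChange A) =
      (BilinForm.toMatrix b B).map (algebraMap R A) := by
  ext i j
  simp [BilinForm.toMatrix_apply, Algebra.algebraMap_eq_smul_one]

open Module in
/-- A bilinear form on a finite free module over a local ring is perfect if its reduction to the
residue field is nondegenerate. -/
theorem LinearMap.BilinForm.bijective_of_nondegenerate_baseChange_residueField {R N : Type*}
    [CommRing R] [IsLocalRing R] [AddCommGroup N] [Module R N] [Module.Free R N]
    [Module.Finite R N] (B : LinearMap.BilinForm R N)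
    (h : (B.baseChange (IsLocalRing.ResidueField R)).Nondegenerate) :
    Function.Bijective B := by
  classical
  let b := Module.Free.chooseBasis R N
  refine B.bijective_of_isUnit_det_toMatrix b ?_
  rw [BilinForm.nondegenerate_iff_det_ne_zero (b.baseChange _),
    BilinForm.toMatrix_baseChange (IsLocalRing.ResidueField R) b B,
    ← RingHom.mapMatrix_apply, ← RingHom.map_det] at h
  exact (IsLocalRing.residue_ne_zero_iff_isUnit _).mp h

/-- If a symmetric bilinear form is perfect on a submodule, then the submodule and its orthogonal
are complementary. -/
theorem LinearMap.BilinForm.isCompl_orthogonal_of_bijective_restrict {R M : Type*} [CommRing R]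
    [AddCommGroup M] [Module R M] (B : LinearMap.BilinForm R M) (hsymm : ∀ x y, B x y = B y x)
    (N : Submodule R M) (h : Function.Bijective (B.restrict N)) :
    IsCompl N (B.orthogonal N) := by
  constructor
  · rw [Submodule.disjoint_def]
    intro x hx hxo
    have hx0 : (⟨x, hx⟩ : N) = 0 := h.1 <| by
      ext n
      simpa [hsymm x n] using hxo n n.2
    simpa using hx0
  · rw [codisjoint_iff, Submodule.eq_top_iff']
    intro m
    obtain ⟨n, hn⟩ := h.2 ((B m).domRestrict N)
    refine Submodule.mem_sup.mpr ⟨n, n.2, m - n, fun y hy => ?_, by simp⟩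
    have hny : B n y = B m y := LinearMap.congr_fun hn ⟨y, hy⟩
    change B y (m - n) = 0
    rw [map_sub, hsymm y m, hsymm y n, hny, sub_self]

/-- Over a commutative local ring `R` with residue field `k`, if `N` is a
finite free submodule of a module `M` carrying a symmetric bilinear form `B`, and the
reduction to `N ⊗ k` of the restriction of `B` to `N` is nondegenerate, then `M`
decomposes as the internal direct sum of `N` and its orthogonal complement
`N^⊥ = {x ∈ M : B(n, x) = 0 for all n ∈ N}`. -/
theorem stmt_3 {R : Type*} [CommRing R] [IsLocalRing R]
    {M : Type*} [AddCommGroup M] [Module R M]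
    (B : LinearMap.BilinForm R M) (hsymm : ∀ x y, B x y = B y x)
    (N : Submodule R M) [Module.Free R N] [Module.Finite R N]
    (hnd : ((B.restrict N).baseChange (IsLocalRing.ResidueField R)).Nondegenerate) :
    IsCompl N (B.orthogonal N) := by
  exact B.isCompl_orthogonal_of_bijective_restrict hsymm N
    ((B.restrict N).bijective_of_nondegenerate_baseChange_residueField hnd)
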